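/- Let f_1, …, f_k ∈ ℤ[x_1, …, x_n] be nonzero polynomials (k, n ≥ 1), let D = max_i deg(f_i) ≥ 1, and let h = max_i h(f_i), where h(g) is the logarithm of the maximum absolute value of the coefficients of g. If the system F = (f_1, …, f_k) has no common zero in ℂ^n, then the number of primes p such that the mod-p reductions of f_1, …, f_k have a common zero in 𝔽_p^n is at most A_F := 4n(n+1)D^n(h + log k + (n+7)·log((n+1)·D)). -/

import Mathlib

open scoped Classical

noncomputable section

/-- The height of an integer multivariate polynomial: the logarithm of the maximum of the
absolute values of its coefficients. -/
def height {n : ℕ} (g : MvPolynomial (Fin n) ℤ) : ℝ :=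
  Real.log ((g.support.sup fun m => (g.coeff m).natAbs : ℕ) : ℝ)

lemma aux_matroid {A : Type} [Field A] [CharZero A] {ι : Type} [Fintype ι] (x : ι → A)
    (hx : AlgebraicIndependent ℤ x) (s : Set A)
    (h : ∀ i, IsAlgebraic (Algebra.adjoin ℤ s) (x i)) :
    ∃ I ⊆ s, AlgebraicIndepOn ℤ id I ∧ (Fintype.card ι : ℕ∞) ≤ I.encard := by
  have : FaithfulSMul ℤ A := (faithfulSMul_iff_algebraMap_injective ℤ A).mpr
    (by simpa using Int.cast_injective)
  obtain ⟨I, hI⟩ := (AlgebraicIndependent.matroid ℤ A).exists_isBasis s (Set.subset_univ _)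
  refine ⟨I, hI.subset, hI.indep, ?_⟩
  rw [hI.encard_eq_eRk]
  have h1 : (AlgebraicIndependent.matroid ℤ A).Indep (Set.range x) := hx.to_subtype_range
  have h2 : Set.range x ⊆ (AlgebraicIndependent.matroid ℤ A).closure s := by
    rintro _ ⟨i, rfl⟩
    rw [AlgebraicIndependent.matroid_closure_eq]
    exact h i
  have h3 : (Set.range x).encard = Fintype.card ι := by
    rw [← Set.image_univ, hx.injective.encard_image, Set.encard_univ]
    simp
  rw [← h3, ← h1.eRk_eq_encard, ← Matroid.eRk_closure_eq _ s]
  exact Matroid.eRk_mono _ h2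

lemma aux_lift {L : Type} [Field L] (V : ValuationSubring L) {ι : Type} (e : ι → V)
    (he : AlgebraicIndependent ℤ (fun i => IsLocalRing.residue V (e i)))
    (π : V) (hπ : π ∈ IsLocalRing.maximalIdeal V) (hπ0 : π ≠ 0) :
    AlgebraicIndependent ℤ (fun o : Option ι => ((o.elim π e : V) : L)) := by
  have key : ∀ m : ℕ, ∀ Q : Polynomial (MvPolynomial ι ℤ), Q.natDegree ≤ m →
      Polynomial.eval₂ (MvPolynomial.aeval e : MvPolynomial ι ℤ →ₐ[ℤ] V).toRingHom π Q = 0 →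
      Q = 0 := by
    have c0 : ∀ Q : Polynomial (MvPolynomial ι ℤ),
      Polynomial.eval₂ (MvPolynomial.aeval e : MvPolynomial ι ℤ →ₐ[ℤ] V).toRingHom π Q = 0 →
        Q.coeff 0 = 0 := by
      intro Q hQ
      have h1 := congrArg (IsLocalRing.residue V) hQ
      rw [← Polynomial.divX_mul_X_add Q] at h1
      simp only [Polynomial.eval₂_add, Polynomial.eval₂_mul, Polynomial.eval₂_X,
        Polynomial.eval₂_C, map_add, map_mul, map_zero] at h1
      rw [(IsLocalRing.residue_eq_zero_iff π).2 hπ] at h1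
      simp only [mul_zero, zero_add] at h1
      apply he.eq_zero_of_aeval_eq_zero
      rw [← h1]
      change _ = IsLocalRing.residue V (MvPolynomial.aeval e (Q.coeff 0))
      rw [MvPolynomial.aeval_def, MvPolynomial.aeval_def, MvPolynomial.eval₂_comp_left]
      congr 1
    intro m
    induction m with
    | zero =>
      intro Q hd hQ
      rw [Polynomial.eq_C_of_natDegree_le_zero hd, c0 Q hQ, map_zero]
    | succ m ih =>
      intro Q hd hQ
      have h0 := c0 Q hQ
      have h1 := Polynomial.divX_mul_X_add Q
      rw [h0, map_zero, add_zero] at h1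
      rw [← h1] at hQ
      simp only [Polynomial.eval₂_mul, Polynomial.eval₂_X, mul_eq_zero, hπ0, or_false] at hQ
      have h2 := ih Q.divX (by rw [Polynomial.natDegree_divX_eq_natDegree_tsub_one]; omega) hQ
      rw [← h1, h2, zero_mul]
  rw [algebraicIndependent_iff]
  intro P hP
  have : MvPolynomial.optionEquivLeft ℤ ι P = 0 := by
    apply key _ _ le_rfl
    apply Subtype.val_injective
    rw [ZeroMemClass.coe_zero, ← hP]
    have hc : ((V.subtype).comp ((Polynomial.eval₂RingHom (MvPolynomial.aeval e : MvPolynomial ι ℤ →ₐ[ℤ] V).toRingHom π).comp (MvPolynomial.optionEquivLeft ℤ ι).toAlgHom.toRingHom)) = (MvPolynomial.aeval (R := ℤ) (fun o : Option ι => ((o.elim π e : V) : L))).toRingHom := by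
      apply MvPolynomial.ringHom_ext
      · intro r; simp
      · intro o
        cases o <;> simp [MvPolynomial.optionEquivLeft_X_none, MvPolynomial.optionEquivLeft_X_some]
    exact DFunLike.congr_fun hc P
  simpa using this

lemma aux_val {L : Type} [Field L] [CharZero L] (V : ValuationSubring L) {n k : ℕ}
    (t : Option (Fin n) → L) (z : L) (x : Fin n → L)
    (F G : Fin k → MvPolynomial (Fin n) ℤ) (N : ℤ) (hN : N ≠ 0)
    (hG : ∑ j, G j * F j = MvPolynomial.C N)
    (h1 : ∀ P : MvPolynomial (Option (Fin n)) ℤ, P ≠ 0 → MvPolynomial.aeval t P ≠ 0 ∧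
      MvPolynomial.aeval t P ∈ V ∧ (MvPolynomial.aeval t P)⁻¹ ∈ V)
    (h2 : ∀ i, i.elim 0 x + z * ∑ j : Fin k, t i ^ (j.val + 1) * MvPolynomial.aeval x (F j) ∈ V) :
    z ∈ V := by
  set u : Fin n ⊕ Fin k → L := Sum.elim x (fun j => z * MvPolynomial.aeval x (F j)) with hu
  by_contra hz
  have hex : ∃ s0, u s0 ∉ V := by
    by_contra hcon
    push Not at hcon
    apply hz
    have hx : ∀ i, x i ∈ V := fun i => hcon (Sum.inl i)
    have hGx : ∀ P : MvPolynomial (Fin n) ℤ, MvPolynomial.aeval x P ∈ V := by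
      intro P
      have : MvPolynomial.aeval x P = ((MvPolynomial.aeval (R := ℤ) (fun i => (⟨x i, hx i⟩ : V)) P : V) : L) := by
        rw [MvPolynomial.aeval_def, MvPolynomial.aeval_def]
        change _ = V.subtype _
        rw [MvPolynomial.eval₂_comp_left]
        congr 1
      rw [this]; exact Subtype.property _
    have e1 : (N : L) * z = ∑ j, MvPolynomial.aeval x (G j) * u (Sum.inr j) := by
      have := congrArg (MvPolynomial.aeval x) hG
      simp only [map_sum, map_mul, MvPolynomial.aeval_C] at this
      simp only [algebraMap_int_eq, eq_intCast] at this
      rw [← this, Finset.sum_mul]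
      refine Finset.sum_congr rfl fun j _ => ?_
      simp [hu]; ring
    have e2 : (N : L) * z ∈ V := by
      rw [e1]
      exact sum_mem fun j _ => mul_mem (hGx _) (hcon _)
    have e3 := h1 (MvPolynomial.C N) (by simpa using hN)
    simp only [eq_intCast, map_intCast] at e3
    have := mul_mem e3.2.2 e2
    rwa [← mul_assoc, inv_mul_cancel₀ e3.1, one_mul] at this
  obtain ⟨s0, hs0⟩ := hex
  obtain ⟨s, -, hs⟩ := Finset.exists_max_image Finset.univ (fun i => V.valuation (u i)) ⟨s0, Finset.mem_univ _⟩
  have hs1 : 1 < V.valuation (u s) := by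
    refine lt_of_lt_of_le ?_ (hs s0 (Finset.mem_univ _))
    rw [← not_le, V.valuation_le_one_iff]; exact hs0
  set ρ := u s with hρ
  have hρ0 : ρ ≠ 0 := by
    intro h; rw [h, map_zero] at hs1; exact absurd hs1 (by simp)
  have hw : ∀ i, u i * ρ⁻¹ ∈ V := by
    intro i
    rw [← V.valuation_le_one_iff, map_mul, map_inv₀]
    exact mul_inv_le_one_of_le₀ (hs i (Finset.mem_univ _)) zero_le
  have hπl : V.valuation ρ⁻¹ < 1 := by
    rw [map_inv₀]; exact inv_lt_one_of_one_lt₀ hs1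
  have hπV : ρ⁻¹ ∈ V := (V.valuation_le_one_iff _).1 hπl.le
  let π : V := ⟨ρ⁻¹, hπV⟩
  have hπm : π ∈ IsLocalRing.maximalIdeal V := (V.valuation_lt_one_iff π).2 hπl
  have hπ0 : π ≠ 0 := by
    intro h; exact inv_ne_zero hρ0 (congrArg Subtype.val h)
  let w : Fin n ⊕ Fin k → V := fun i => ⟨u i * ρ⁻¹, hw i⟩
  have htV : ∀ i, t i ∈ V := by
    intro i
    have := (h1 (MvPolynomial.X i) (MvPolynomial.X_ne_zero i)).2.1
    simpa using this
  let T : Option (Fin n) → V := fun i => ⟨t i, htV i⟩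
  let r := IsLocalRing.residue V
  have hrel : ∀ i : Option (Fin n), i.elim 0 (fun a => r (w (Sum.inl a))) +
      ∑ j : Fin k, r (T i) ^ (j.val + 1) * r (w (Sum.inr j)) = 0 := by
    intro i
    have e1 : (i.elim 0 (fun a => w (Sum.inl a)) + ∑ j : Fin k, T i ^ (j.val + 1) * w (Sum.inr j) : V)
        = π * ⟨_, h2 i⟩ := by
      apply V.subtype_injective
      simp only [map_add, map_sum, map_mul, map_pow]
      simp only [ValuationSubring.subtype_apply, T, w, π, hu, Sum.elim_inr]
      rw [mul_add, ← mul_assoc, Finset.mul_sum]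
      congr 1
      · cases i <;> simp [mul_comm]
      · refine Finset.sum_congr rfl fun j _ => ?_
        ring
    have e2 := congrArg r e1
    rw [map_mul, (IsLocalRing.residue_eq_zero_iff π).2 hπm, zero_mul] at e2
    refine Eq.trans ?_ e2
    simp only [map_add, map_sum, map_mul, map_pow]
    congr 1
    cases i
    · exact (map_zero r).symm
    · rfl
  have hws : w s = 1 := by
    apply Subtype.val_injective
    simp only [w, ← hρ]
    rw [mul_inv_cancel₀ hρ0]; rfl
  have hj : ∃ j, r (w (Sum.inr j)) ≠ 0 := by
    by_contra hcon
    push Not at hcon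
    have hi : ∀ i, r (w (Sum.inl i)) = 0 := by
      intro i
      have := hrel (some i)
      simpa [hcon] using this
    have : r (w s) = 0 := by
      cases s with
      | inl a => exact hi a
      | inr a => exact hcon a
    rw [hws, map_one] at this
    exact one_ne_zero this
  obtain ⟨j0, hj0⟩ := hj
  have hTi : AlgebraicIndependent ℤ (fun i => r (T i)) := by
    rw [algebraicIndependent_iff]
    intro P hP
    by_contra hP0
    obtain ⟨a1, a2, a3⟩ := h1 P hP0
    have e1 : ((MvPolynomial.aeval T P : V) : L) = MvPolynomial.aeval t P := by
      rw [MvPolynomial.aeval_def, MvPolynomial.aeval_def]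
      change V.subtype _ = _
      rw [MvPolynomial.eval₂_comp_left]
      congr 1
    have e2 : r (MvPolynomial.aeval T P) = 0 := by
      rw [← hP, MvPolynomial.aeval_def, MvPolynomial.aeval_def, MvPolynomial.eval₂_comp_left]
      congr 1
    have e3 : (MvPolynomial.aeval T P : V) * ⟨_, a3⟩ = 1 := by
      apply V.subtype_injective
      rw [map_mul, map_one]
      simp only [ValuationSubring.subtype_apply, e1]
      exact mul_inv_cancel₀ a1
    have e4 := congrArg r e3
    rw [map_mul, e2, zero_mul, map_one] at e4
    exact zero_ne_one e4
  have hch : CharZero (IsLocalRing.ResidueField V) := by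
    have := hTi.algebraMap_injective
    exact ⟨fun a b hab => by
      have := @this (a : ℤ) (b : ℤ) (by simpa using hab)
      exact_mod_cast this⟩
  have hTalg : ∀ i, IsAlgebraic (Algebra.adjoin ℤ (Set.range fun i => r (w i))) (r (T i)) := by
    intro i
    let W : Fin n ⊕ Fin k → Algebra.adjoin ℤ (Set.range fun i => r (w i)) :=
      fun i => ⟨r (w i), Algebra.subset_adjoin ⟨i, rfl⟩⟩
    refine ⟨Polynomial.C (i.elim 0 (fun a => W (Sum.inl a))) +
      ∑ j : Fin k, Polynomial.monomial (j.val + 1) (W (Sum.inr j)), ?_, ?_⟩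
    · intro h0
      have := congrArg (fun p => Polynomial.coeff p (j0.val + 1)) h0
      simp only [Polynomial.coeff_add, Polynomial.coeff_C_succ, Polynomial.finsetSum_coeff,
        Polynomial.coeff_monomial, Polynomial.coeff_zero, zero_add] at this
      rw [Finset.sum_eq_single j0] at this
      · simp only [if_true] at this
        exact hj0 (congrArg Subtype.val this)
      · intro b _ hb
        rw [if_neg]
        intro h; apply hb; ext; omega
      · simp
    · rw [← hrel i]
      simp only [map_add, map_sum, Polynomial.aeval_C, Polynomial.aeval_monomial]
      congr 1
      · cases i <;> rfl
      · refine Finset.sum_congr rfl fun j _ => ?_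
        rw [mul_comm]; rfl
  obtain ⟨I, hIs, hI, hIc⟩ := aux_matroid _ hTi _ hTalg
  have hIfin : I.Finite := (Set.finite_range _).subset hIs
  have : Fintype I := hIfin.fintype
  choose idx hidx using fun i : I => hIs i.2
  have hlift := aux_lift V (fun i : I => w (idx i)) (by
    have : (fun i : I => IsLocalRing.residue V (w (idx i))) = fun i : I => id (i : IsLocalRing.ResidueField V) := by
      funext i; exact hidx i
    rw [this]; exact hI) π hπm hπ0
  set S : Set L := Set.range (fun o : Option (Fin n) => o.elim z x) with hS
  have hxS : ∀ i, x i ∈ Algebra.adjoin ℤ S := fun i => Algebra.subset_adjoin ⟨some i, rfl⟩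
  have hzS : z ∈ Algebra.adjoin ℤ S := Algebra.subset_adjoin ⟨none, rfl⟩
  have huS : ∀ i, u i ∈ Algebra.adjoin ℤ S := by
    intro i
    cases i with
    | inl a => exact hxS a
    | inr a =>
      refine mul_mem hzS ?_
      have : MvPolynomial.aeval x (F a) = ((MvPolynomial.aeval (R := ℤ) (fun i => (⟨x i, hxS i⟩ : Algebra.adjoin ℤ S)) (F a) : Algebra.adjoin ℤ S) : L) := by
        rw [MvPolynomial.aeval_def, MvPolynomial.aeval_def]
        change _ = (Algebra.adjoin ℤ S).val.toRingHom _
        rw [MvPolynomial.eval₂_comp_left]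
        congr 1
      rw [this]; exact Subtype.property _
  have halg : ∀ a ∈ Algebra.adjoin ℤ S, IsAlgebraic (Algebra.adjoin ℤ S) a := fun a ha =>
    isAlgebraic_algebraMap (⟨a, ha⟩ : Algebra.adjoin ℤ S)
  obtain ⟨I', hI's, -, hI'c⟩ := aux_matroid _ hlift S (by
    intro o
    cases o with
    | none => exact (halg _ (huS s)).inv
    | some i => exact (halg _ (huS _)).mul (halg _ (huS s)).inv)
  have c1 : I'.encard ≤ (n + 1 : ℕ) := by
    refine (Set.encard_le_encard hI's).trans ?_
    rw [hS, ← Set.image_univ]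
    refine (Set.encard_image_le _ _).trans ?_
    rw [Set.encard_univ]; simp
  have c2 := hI'c.trans c1
  rw [Set.encard_eq_coe_toFinset_card, Set.toFinset_card] at hIc
  simp only [Fintype.card_option, Fintype.card_fin, Nat.cast_le] at c2 hIc
  omega

open Polynomial in
lemma aux_ufd {B : Type} [CommRing B] [IsDomain B] [UniqueFactorizationMonoid B]
    (I : Ideal B[X]) [hI : I.IsPrime] (hIB : ∀ b : B, C b ∈ I → b = 0)
    (R E : B[X]) (hR : R ∈ I) (hE : E ∈ I) (hE0 : E ≠ 0) :
    ∃ E0 ∈ I, E0 ∣ E ∧ E0 ∣ R := by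
  obtain ⟨f, hf, hfa⟩ := UniqueFactorizationMonoid.exists_prime_factors E hE0
  have h1 : f.prod ∈ I := by
    obtain ⟨u, hu⟩ := hfa
    have h : f.prod * u ∈ I := by rw [hu]; exact hE
    refine (hI.mem_or_mem h).resolve_right ?_
    intro hu'
    exact hI.ne_top (Ideal.eq_top_of_isUnit_mem _ hu' u.isUnit)
  obtain ⟨E0, hE0f, hE0I⟩ := (hI.multiset_prod_mem_iff_exists_mem f).1 h1
  have hpr := hf E0 hE0f
  refine ⟨E0, hE0I, (Multiset.dvd_prod hE0f).trans hfa.dvd, ?_⟩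
  have hdeg : ∀ b : B, b ≠ 0 → ¬ E0 ∣ C b := by
    intro b hb hd
    obtain ⟨c, hc⟩ := hd
    have h2 := congrArg natDegree hc
    have hc0 : c ≠ 0 := by rintro rfl; simp at hc; exact hb hc
    rw [natDegree_C, natDegree_mul hpr.ne_zero hc0] at h2
    have h3 : E0 = C (E0.coeff 0) := eq_C_of_natDegree_eq_zero (by omega)
    rw [h3] at hE0I
    have := hIB _ hE0I
    rw [this, map_zero] at h3
    exact hpr.ne_zero h3
  -- minimal degree element
  have hex : ∃ m, ∃ G ∈ I, G ≠ 0 ∧ G.natDegree = m := ⟨_, E, hE, hE0, rfl⟩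
  obtain ⟨G, hGI, hG0, hGd⟩ := Nat.find_spec hex
  have hmin : ∀ H ∈ I, H.natDegree < G.natDegree → H = 0 := by
    intro H hH hlt
    by_contra hne
    exact Nat.find_min hex (hGd ▸ hlt) ⟨H, hH, hne, rfl⟩
  have hlc : G.leadingCoeff ≠ 0 := leadingCoeff_ne_zero.2 hG0
  have hGpos : 0 < G.natDegree := by
    rw [Nat.pos_iff_ne_zero]
    intro h0
    have h3 : G = C (G.coeff 0) := eq_C_of_natDegree_eq_zero h0
    rw [h3] at hGI
    have := hIB _ hGI
    rw [this, map_zero] at h3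
    exact hG0 h3
  have key : ∀ m : ℕ, ∀ H ∈ I, H.natDegree ≤ m → ∃ s : ℕ, G ∣ C (G.leadingCoeff ^ s) * H := by
    intro m
    induction m with
    | zero =>
      intro H hH hd
      exact ⟨0, by rw [hmin H hH (by omega)]; simp⟩
    | succ m ih =>
      intro H hH hd
      by_cases hlt : H.natDegree < G.natDegree
      · exact ⟨0, by rw [hmin H hH hlt]; simp⟩
      · push Not at hlt
        have h4 := natDegree_cancelLeads_lt_of_natDegree_le_natDegree hlt (by omega)
        have h5 : G.cancelLeads H ∈ I := by
          unfold cancelLeads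
          exact sub_mem (Ideal.mul_mem_left _ _ hH) (Ideal.mul_mem_left _ _ hGI)
        obtain ⟨s, hs⟩ := ih _ h5 (by omega)
        refine ⟨s + 1, ?_⟩
        have h6 : C (G.leadingCoeff ^ (s+1)) * H = C (G.leadingCoeff ^ s) * G.cancelLeads H +
            G * (C (G.leadingCoeff ^ s) * C H.leadingCoeff * X ^ (H.natDegree - G.natDegree)) := by
          unfold cancelLeads
          have : G.natDegree - H.natDegree = 0 := by omega
          rw [this, pow_zero, pow_succ, C_mul]
          ring
        rw [h6]; exact dvd_add hs (Dvd.intro _ rfl)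
  have hdvdG : E0 ∣ G := by
    obtain ⟨s, Q, hQ⟩ := key _ E0 hE0I le_rfl
    have : E0 ∣ G * Q := ⟨C (G.leadingCoeff ^ s), by rw [← hQ, mul_comm]⟩
    rcases hpr.dvd_or_dvd this with h | ⟨Q', hQ'⟩
    · exact h
    · exfalso
      rw [hQ', mul_left_comm, mul_comm] at hQ
      have h7 := mul_left_cancel₀ hpr.ne_zero hQ
      have h8 := congrArg natDegree h7
      have hQ0 : Q' ≠ 0 := by
        rintro rfl; rw [mul_zero] at h7; exact pow_ne_zero s hlc (C_eq_zero.1 h7)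
      rw [natDegree_C, natDegree_mul hG0 hQ0] at h8
      omega
  obtain ⟨s, hs⟩ := key _ R hR le_rfl
  rcases hpr.dvd_or_dvd (hdvdG.trans hs) with h | h
  · exact absurd h (hdeg _ (pow_ne_zero s hlc))
  · exact h

lemma aux_degvar {σ : Type} (c : MvPolynomial σ ℤ) (i : σ) :
    c.degreeOf i = 0 ↔ i ∉ c.vars := by
  rw [MvPolynomial.degreeOf_def, MvPolynomial.vars_def, Multiset.count_eq_zero, Multiset.mem_toFinset]

lemma aux_rename {τ : Type} (c d : MvPolynomial (τ ⊕ τ) ℤ) (b : MvPolynomial τ ℤ)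
    (h : c * d = MvPolynomial.rename Sum.inl b) (hc : c ≠ 0) (hd : d ≠ 0) :
    ∃ a : MvPolynomial τ ℤ, c = MvPolynomial.rename Sum.inl a := by
  have hv : (c.vars : Set (τ ⊕ τ)) ⊆ Set.range Sum.inl := by
    intro v hv
    rcases v with i | i
    · exact ⟨i, rfl⟩
    · exfalso
      have h1 := congrArg (MvPolynomial.degreeOf (Sum.inr i)) h
      rw [MvPolynomial.degreeOf_mul_eq hc hd] at h1
      have h2 : MvPolynomial.degreeOf (Sum.inr i) (MvPolynomial.rename (Sum.inl : τ → τ ⊕ τ) b) = 0 := by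
        rw [aux_degvar]
        intro hm
        have := MvPolynomial.mem_vars_rename Sum.inl b hm
        simp at this
      rw [h2] at h1
      have h3 : c.degreeOf (Sum.inr i) = 0 := by omega
      exact (aux_degvar _ _).1 h3 hv
  obtain ⟨a, ha⟩ := MvPolynomial.exists_rename_eq_of_vars_subset_range c Sum.inl Sum.inl_injective hv
  exact ⟨a, ha.symm⟩

lemma aux_null {n k : ℕ} (F : Fin k → MvPolynomial (Fin n) ℤ)
    (hnoroot : ∀ x : Fin n → ℂ, ∃ i, MvPolynomial.aeval x (F i) ≠ 0) :
    ∃ N : ℤ, N ≠ 0 ∧ ∃ G : Fin k → MvPolynomial (Fin n) ℤ, ∑ j, G j * F j = MvPolynomial.C N := by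
  let φ : MvPolynomial (Fin n) ℤ →+* MvPolynomial (Fin n) ℚ := MvPolynomial.map (Int.castRingHom ℚ)
  have h1 : MvPolynomial.zeroLocus ℂ (Ideal.span (Set.range fun j => φ (F j))) = ∅ := by
    rw [MvPolynomial.zeroLocus_span]
    ext x
    simp only [Set.mem_range, forall_exists_index, forall_apply_eq_imp_iff, Set.mem_ofPred_eq,
      Set.mem_empty_iff_false, iff_false, not_forall]
    obtain ⟨i, hi⟩ := hnoroot x
    refine ⟨i, ?_⟩
    intro h
    apply hi
    rw [← h]
    simp [φ, MvPolynomial.aeval_def, MvPolynomial.eval₂_map]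
    congr 1
  have h2 := MvPolynomial.vanishingIdeal_zeroLocus_eq_radical (K := ℂ) (Ideal.span (Set.range fun j => φ (F j)))
  rw [h1] at h2
  have h3 : (1 : MvPolynomial (Fin n) ℚ) ∈ Ideal.span (Set.range fun j => φ (F j)) := by
    rw [← Ideal.eq_top_iff_one, ← Ideal.radical_eq_top, ← h2]
    exact MvPolynomial.vanishingIdeal_empty
  rw [Ideal.mem_span_range_iff_exists_fun] at h3
  obtain ⟨c, hc⟩ := h3
  have h4 : ∀ p : MvPolynomial (Fin n) ℚ, ∃ d : ℤ, d ≠ 0 ∧ ∃ g : MvPolynomial (Fin n) ℤ,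
      φ g = MvPolynomial.C (d : ℚ) * p := by
    intro p
    induction p using MvPolynomial.induction_on' with
    | monomial u a =>
      refine ⟨a.den, by exact_mod_cast a.den_nz, MvPolynomial.monomial u a.num, ?_⟩
      simp only [φ, MvPolynomial.map_monomial, MvPolynomial.C_mul_monomial]
      congr 1
      simp [Rat.den_mul_eq_num]
    | add p q hp hq =>
      obtain ⟨d, hd, g, hg⟩ := hp
      obtain ⟨d', hd', g', hg'⟩ := hq
      refine ⟨d * d', mul_ne_zero hd hd', MvPolynomial.C d' * g + MvPolynomial.C d * g', ?_⟩
      rw [map_add, map_mul, map_mul, hg, hg']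
      simp [φ]
      ring
  choose d hd g hg using h4
  refine ⟨∏ j, d (c j), Finset.prod_ne_zero_iff.2 fun j _ => hd _,
    fun j => MvPolynomial.C (∏ i ∈ Finset.univ.erase j, d (c i)) * g (c j), ?_⟩
  apply MvPolynomial.map_injective (Int.castRingHom ℚ) Int.cast_injective
  change φ _ = φ _
  rw [map_sum]
  have : ∀ j, φ (MvPolynomial.C (∏ i ∈ Finset.univ.erase j, d (c i)) * g (c j) * F j) =
     φ (MvPolynomial.C (∏ j, d (c j))) * (c j * φ (F j)) := by
    intro j
    rw [← Finset.prod_erase_mul Finset.univ _ (Finset.mem_univ j)]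
    rw [map_mul, map_mul, hg, MvPolynomial.C_mul, map_mul]
    simp only [φ, eq_intCast, map_intCast]
    ring
  rw [Finset.sum_congr rfl fun j _ => this j, ← Finset.mul_sum, hc, mul_one]

abbrev Tg (n : ℕ) := MvPolynomial (Option (Option (Fin n)) ⊕ Fin n) ℤ
abbrev Bs (n : ℕ) := MvPolynomial (Option (Fin n) ⊕ Option (Fin n)) ℤ
def zT (n : ℕ) : Tg n := MvPolynomial.X (Sum.inl none)
def tT {n : ℕ} (i : Option (Fin n)) : Tg n := MvPolynomial.X (Sum.inl (some i))
def gT {n k : ℕ} (F : Fin k → MvPolynomial (Fin n) ℤ) (i : Option (Fin n)) : Tg n :=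
  ∑ j : Fin k, tT i ^ (j.val + 1) * MvPolynomial.rename Sum.inr (F j)
def qT {n k : ℕ} (F : Fin k → MvPolynomial (Fin n) ℤ) (i : Option (Fin n)) : Tg n :=
  i.elim 0 (fun j => MvPolynomial.X (Sum.inr j)) + zT n * gT F i
def psiB {n k : ℕ} (F : Fin k → MvPolynomial (Fin n) ℤ) : Bs n →ₐ[ℤ] Tg n :=
  MvPolynomial.aeval (Sum.elim tT (qT F))
def psi {n k : ℕ} (F : Fin k → MvPolynomial (Fin n) ℤ) : Polynomial (Bs n) →+* Tg n :=
  Polynomial.eval₂RingHom (psiB F : Bs n →+* Tg n) (zT n)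

lemma aux_Xdvd {σ : Type} (v : σ) (e : MvPolynomial σ ℤ →+* MvPolynomial σ ℤ)
    (hv : e (MvPolynomial.X v) = 0) (hw : ∀ w, w ≠ v → e (MvPolynomial.X w) = MvPolynomial.X w)
    (P : MvPolynomial σ ℤ) :
    MvPolynomial.X v ∣ P - e P := by
  rw [← Ideal.mem_span_singleton, ← Ideal.Quotient.eq]
  set m := Ideal.Quotient.mk (Ideal.span {(MvPolynomial.X v : MvPolynomial σ ℤ)})
  have : m = m.comp e := by
    apply MvPolynomial.ringHom_ext
    · intro r; simp
    · intro w
      rw [RingHom.comp_apply]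
      by_cases h : w = v
      · subst h
        rw [hv, map_zero]
        exact Ideal.Quotient.eq_zero_iff_mem.2 (Ideal.mem_span_singleton_self _)
      · rw [hw w h]
  exact congrArg (fun f : MvPolynomial σ ℤ →+* _ => f P) this

lemma gT_ne_zero {n k : ℕ} (hk : 0 < k) (F : Fin k → MvPolynomial (Fin n) ℤ) (hF : ∀ i, F i ≠ 0) :
    gT F none ≠ 0 := by
  intro h
  let χ : Tg n →+* Polynomial (MvPolynomial (Fin n) ℤ) :=
    MvPolynomial.eval₂Hom (Int.castRingHom _) (Sum.elim (fun _ => Polynomial.X) (fun j => Polynomial.C (MvPolynomial.X j)))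
  have h0 : ∀ P : MvPolynomial (Fin n) ℤ, χ (MvPolynomial.rename Sum.inr P) = Polynomial.C P := by
    intro P
    have : χ.comp (MvPolynomial.rename Sum.inr : MvPolynomial (Fin n) ℤ →ₐ[ℤ] Tg n).toRingHom = Polynomial.C := by
      apply MvPolynomial.ringHom_ext
      · intro r; simp
      · intro w; simp [χ]
    exact congrArg (fun f : MvPolynomial (Fin n) ℤ →+* _ => f P) this
  have h1 : χ (gT F none) = ∑ j : Fin k, Polynomial.X ^ (j.val+1) * Polynomial.C (F j) := by
    unfold gT
    rw [map_sum]
    refine Finset.sum_congr rfl fun j _ => ?_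
    rw [map_mul, map_pow, h0]
    simp [χ, tT]
  rw [h, map_zero] at h1
  have h2 := congrArg (fun p => Polynomial.coeff p 1) h1
  simp only [Polynomial.coeff_zero, Polynomial.finsetSum_coeff, Polynomial.coeff_mul_C, Polynomial.coeff_X_pow] at h2
  rw [Finset.sum_eq_single ⟨0, hk⟩] at h2
  · simp at h2
    exact hF _ h2.symm
  · intro b _ hb
    rw [if_neg, zero_mul]
    intro h3
    apply hb
    ext
    simp; omega
  · simp

lemma qT_ne_zero {n k : ℕ} (hk : 0 < k) (F : Fin k → MvPolynomial (Fin n) ℤ) (hF : ∀ i, F i ≠ 0) :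
    qT F none ≠ 0 := by
  simp only [qT, Option.elim_none, zero_add]
  exact mul_ne_zero (MvPolynomial.X_ne_zero _) (gT_ne_zero hk F hF)

lemma psiB_inj {n k : ℕ} (hk : 0 < k) (F : Fin k → MvPolynomial (Fin n) ℤ) (hF : ∀ i, F i ≠ 0) :
    ∀ P : Bs n, psiB F P = 0 → P = 0 := by
  have key : ∀ m : ℕ, ∀ P : Bs n, P.totalDegree ≤ m → psiB F P = 0 → P = 0 := by
    intro m
    have hdvd : ∀ P : Bs n, psiB F P = 0 → ∃ Q, P = Q * MvPolynomial.X (Sum.inr none) ∧ psiB F Q = 0 := by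
      intro P hP
      let ε : Tg n →ₐ[ℤ] Bs n := MvPolynomial.aeval (Sum.elim
        (fun o => o.elim 0 (fun i => MvPolynomial.X (Sum.inl i))) (fun j => MvPolynomial.X (Sum.inr (some j))))
      have h2 := aux_Xdvd (Sum.inr none) (ε.comp (psiB F)).toRingHom (by simp [psiB, ε, qT, zT]) (by
        rintro (i | (_ | i)) hw
        · simp [psiB, ε, tT]
        · exact absurd rfl hw
        · simp [psiB, ε, qT, zT]) P
      have h3 : (ε.comp (psiB F)).toRingHom P = 0 := by
        change ε (psiB F P) = 0
        rw [hP, map_zero]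
      rw [h3, sub_zero] at h2
      obtain ⟨Q, hQ⟩ := h2
      refine ⟨Q, by rw [hQ, mul_comm], ?_⟩
      rw [hQ, map_mul] at hP
      refine (mul_eq_zero.1 hP).resolve_left ?_
      simp only [psiB, MvPolynomial.aeval_X, Sum.elim_inr]
      exact qT_ne_zero hk F hF
    induction m with
    | zero =>
      intro P hd hP
      obtain ⟨Q, hQ, hQ0⟩ := hdvd P hP
      by_contra hne
      have : Q ≠ 0 := by rintro rfl; simp at hQ; exact hne hQ
      rw [hQ, MvPolynomial.totalDegree_mul_of_isDomain this (MvPolynomial.X_ne_zero _), MvPolynomial.totalDegree_X] at hd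
      omega
    | succ m ih =>
      intro P hd hP
      obtain ⟨Q, hQ, hQ0⟩ := hdvd P hP
      by_contra hne
      have hQn : Q ≠ 0 := by rintro rfl; simp at hQ; exact hne hQ
      rw [hQ, MvPolynomial.totalDegree_mul_of_isDomain hQn (MvPolynomial.X_ne_zero _), MvPolynomial.totalDegree_X] at hd
      exact hQn (ih Q (by omega) hQ0)
  exact fun P => key _ P le_rfl

lemma aux_aeval {σ L : Type} [CommRing L] (f : MvPolynomial σ ℤ →+* L) (g : σ → L)
    (hfg : ∀ i, f (MvPolynomial.X i) = g i) (P : MvPolynomial σ ℤ) :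
    MvPolynomial.aeval g P = f P := by
  have : (MvPolynomial.aeval g : MvPolynomial σ ℤ →ₐ[ℤ] L).toRingHom = f := by
    apply MvPolynomial.ringHom_ext
    · intro r; simp
    · intro w; simp [hfg]
  exact congrArg (fun f : MvPolynomial σ ℤ →+* _ => f P) this

def uL {n k : ℕ} (F : Fin k → MvPolynomial (Fin n) ℤ) : Bs n →+* FractionRing (Tg n) :=
  (algebraMap (Tg n) (FractionRing (Tg n))).comp (psiB F : Bs n →+* Tg n)

def rn {n : ℕ} : MvPolynomial (Option (Fin n)) ℤ →+* Bs n :=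
  (MvPolynomial.rename Sum.inl : MvPolynomial (Option (Fin n)) ℤ →ₐ[ℤ] Bs n)

lemma rn_inj {n : ℕ} : Function.Injective (rn (n := n)) :=
  MvPolynomial.rename_injective _ Sum.inl_injective

lemma uL_inj {n k : ℕ} (hk : 0 < k) (F : Fin k → MvPolynomial (Fin n) ℤ) (hF : ∀ i, F i ≠ 0) :
    Function.Injective (uL F) := by
  rw [injective_iff_map_eq_zero]
  intro P hP
  apply psiB_inj hk F hF
  exact (injective_iff_map_eq_zero _).1 (IsFractionRing.injective (Tg n) (FractionRing (Tg n))) _ hP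

def Asub {n k : ℕ} (F : Fin k → MvPolynomial (Fin n) ℤ) : Subring (FractionRing (Tg n)) where
  carrier := {α | ∃ d : MvPolynomial (Option (Fin n)) ℤ, d ≠ 0 ∧ ∃ b : Bs n, uL F (rn d) * α = uL F b}
  mul_mem' := by
    rintro α β ⟨d, hd, b, hb⟩ ⟨d', hd', b', hb'⟩
    refine ⟨d * d', mul_ne_zero hd hd', b * b', ?_⟩
    rw [map_mul, map_mul, map_mul, ← hb, ← hb']; ring
  one_mem' := ⟨1, one_ne_zero, 1, by simp⟩
  add_mem' := by
    rintro α β ⟨d, hd, b, hb⟩ ⟨d', hd', b', hb'⟩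
    refine ⟨d * d', mul_ne_zero hd hd', rn d' * b + rn d * b', ?_⟩
    rw [map_mul, map_mul, map_add, map_mul, map_mul, ← hb, ← hb']; ring
  zero_mem' := ⟨1, one_ne_zero, 0, by simp⟩
  neg_mem' := by
    rintro α ⟨d, hd, b, hb⟩
    exact ⟨d, hd, -b, by rw [map_neg, ← hb]; ring⟩

lemma z_integral {n k : ℕ} (hk : 0 < k) (F : Fin k → MvPolynomial (Fin n) ℤ) (hF : ∀ i, F i ≠ 0)
    (hnoroot : ∀ x : Fin n → ℂ, ∃ i, MvPolynomial.aeval x (F i) ≠ 0) :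
    IsIntegral (Asub F) (algebraMap (Tg n) (FractionRing (Tg n)) (zT n)) := by
  obtain ⟨N, hN, G, hG⟩ := aux_null F hnoroot
  have h0 := iInf_valuationSubring_superset (s := (Asub F : Set (FractionRing (Tg n))))
  rw [Subring.closure_eq] at h0
  suffices h : algebraMap (Tg n) (FractionRing (Tg n)) (zT n) ∈ (integralClosure (Asub F) (FractionRing (Tg n))).toSubring from h
  rw [← h0, Subring.mem_iInf]
  rintro ⟨V, hV⟩
  have hAu : ∀ b, uL F b ∈ V := fun b => hV ⟨1, one_ne_zero, b, by simp⟩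
  have hat := aux_aeval ((uL F).comp rn) (fun i => algebraMap (Tg n) (FractionRing (Tg n)) (tT i))
    (fun w => by simp [uL, rn, psiB])
  refine aux_val V (fun i => algebraMap (Tg n) (FractionRing (Tg n)) (tT i)) _
    (fun j => algebraMap (Tg n) (FractionRing (Tg n)) (MvPolynomial.X (Sum.inr j))) F G N hN hG ?_ ?_
  · intro P hP
    have hne : uL F (rn P) ≠ 0 := by
      intro h
      rw [← map_zero (uL F)] at h
      have h := uL_inj hk F hF h
      rw [← map_zero rn] at h
      exact hP (rn_inj h)
    rw [hat, RingHom.comp_apply]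
    refine ⟨hne, hAu _, hV ⟨P, hP, 1, ?_⟩⟩
    rw [mul_inv_cancel₀ hne, map_one]
  · intro i
    convert hAu (MvPolynomial.X (Sum.inr i)) using 1
    have hx := aux_aeval ((algebraMap (Tg n) (FractionRing (Tg n))).comp (MvPolynomial.rename Sum.inr : MvPolynomial (Fin n) ℤ →ₐ[ℤ] Tg n).toRingHom)
      (fun j => algebraMap (Tg n) (FractionRing (Tg n)) (MvPolynomial.X (Sum.inr j))) (fun w => by simp)
    simp only [hx, uL, psiB, RingHom.comp_apply, RingHom.coe_coe, MvPolynomial.aeval_X, Sum.elim_inr, qT, gT,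
      map_add, map_mul, map_sum, map_pow]
    congr 1
    cases i <;> simp

open Polynomial in
lemma exists_R {n k : ℕ} (hk : 0 < k) (F : Fin k → MvPolynomial (Fin n) ℤ) (hF : ∀ i, F i ≠ 0)
    (hnoroot : ∀ x : Fin n → ℂ, ∃ i, MvPolynomial.aeval x (F i) ≠ 0) :
    ∃ R : (Bs n)[X], ∃ b : MvPolynomial (Option (Fin n)) ℤ, R ≠ 0 ∧ psi F R = 0 ∧ R.leadingCoeff = rn b := by
  obtain ⟨p, hp, hpz⟩ := z_integral hk F hF hnoroot
  have h1 : ∀ a : Asub F, ∃ d : MvPolynomial (Option (Fin n)) ℤ, d ≠ 0 ∧ ∃ b : Bs n, uL F (rn d) * a.1 = uL F b := fun a => a.2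
  choose d hd b hb using h1
  set N := p.natDegree
  set DD := ∏ i ∈ Finset.range N, d (p.coeff i)
  have hDD : DD ≠ 0 := Finset.prod_ne_zero_iff.2 fun i _ => hd _
  have hDD' : rn DD ≠ 0 := fun h => hDD (rn_inj (h.trans (map_zero rn).symm))
  let S : (Bs n)[X] := ∑ i ∈ Finset.range N, C (rn (∏ j ∈ (Finset.range N).erase i, d (p.coeff j)) * b (p.coeff i)) * X ^ i
  have hS : S.degree < (C (rn DD) * X ^ N).degree := by
    rw [degree_C_mul_X_pow _ hDD']
    refine lt_of_le_of_lt (degree_sum_le _ _) ?_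
    rw [Finset.sup_lt_iff (WithBot.bot_lt_coe _)]
    intro i hi
    refine lt_of_le_of_lt (degree_C_mul_X_pow_le _ _) ?_
    exact_mod_cast Finset.mem_range.1 hi
  have hlc : (S + C (rn DD) * X ^ N).leadingCoeff = rn DD := by
    rw [leadingCoeff_add_of_degree_lt hS]; simp
  refine ⟨S + C (rn DD) * X ^ N, DD, ?_, ?_, hlc⟩
  · intro h
    rw [h, leadingCoeff_zero] at hlc
    exact hDD' hlc.symm
  · apply IsFractionRing.injective (Tg n) (FractionRing (Tg n))
    rw [map_zero]
    have hpsiC : ∀ c, algebraMap (Tg n) (FractionRing (Tg n)) (psi F (C c)) = uL F c := by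
      intro c; simp [psi, uL]
    have hpsiX : psi F X = zT n := by simp [psi]
    simp only [S, map_add, map_sum, map_mul (psi F), map_pow, hpsiX]
    simp only [map_mul (algebraMap (Tg n) (FractionRing (Tg n))), hpsiC, map_pow]
    rw [hp.as_sum] at hpz
    simp only [eval₂_add, eval₂_pow, eval₂_X, eval₂_finsetSum, eval₂_mul, eval₂_C] at hpz
    have h3 : ∀ i ∈ Finset.range N, uL F (rn (∏ j ∈ (Finset.range N).erase i, d (p.coeff j)) * b (p.coeff i)) * (algebraMap (Tg n) (FractionRing (Tg n)) (zT n)) ^ i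
       = uL F (rn DD) * ((p.coeff i).1 * (algebraMap (Tg n) (FractionRing (Tg n)) (zT n)) ^ i) := by
      intro i hi
      rw [map_mul, ← hb]
      simp only [DD]
      rw [← Finset.prod_erase_mul _ _ hi, map_mul rn, map_mul (uL F)]
      ring
    rw [Finset.sum_congr rfl h3, ← Finset.mul_sum, ← mul_add, add_comm]
    have h4 : (algebraMap (Tg n) (FractionRing (Tg n)) (zT n)) ^ N + ∑ i ∈ Finset.range N, (p.coeff i).1 * (algebraMap (Tg n) (FractionRing (Tg n)) (zT n)) ^ i = 0 := hpz
    rw [h4, mul_zero]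

def thetaB {n : ℕ} (p : ℕ) (x : Fin n → ZMod p) : Bs n →+* MvPolynomial (Option (Fin n)) (ZMod p) :=
  MvPolynomial.eval₂Hom (Int.castRingHom _) (Sum.elim MvPolynomial.X (fun i => i.elim 0 (fun j => MvPolynomial.C (x j))))

def chiT {n : ℕ} (p : ℕ) (x : Fin n → ZMod p) : Tg n →+* Polynomial (MvPolynomial (Option (Fin n)) (ZMod p)) :=
  MvPolynomial.eval₂Hom (Int.castRingHom _) (Sum.elim (fun o => o.elim Polynomial.X (fun i => Polynomial.C (MvPolynomial.X i)))
    (fun j => Polynomial.C (MvPolynomial.C (x j))))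

lemma chi_psi {n k : ℕ} (F : Fin k → MvPolynomial (Fin n) ℤ) (p : ℕ) (x : Fin n → ZMod p)
    (hx : ∀ i, MvPolynomial.aeval x (F i) = 0) (E : Polynomial (Bs n)) :
    chiT p x (psi F E) = E.map (thetaB p x) := by
  have hr : ∀ j, chiT p x (MvPolynomial.rename Sum.inr (F j)) = 0 := by
    intro j
    have : (chiT p x).comp (MvPolynomial.rename Sum.inr : MvPolynomial (Fin n) ℤ →ₐ[ℤ] Tg n).toRingHom =
        Polynomial.C.comp (MvPolynomial.C.comp (MvPolynomial.aeval x : MvPolynomial (Fin n) ℤ →ₐ[ℤ] ZMod p).toRingHom) := by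
      apply MvPolynomial.ringHom_ext
      · intro r; simp
      · intro w; simp [chiT]
    have := congrArg (fun f : MvPolynomial (Fin n) ℤ →+* _ => f (F j)) this
    refine this.trans ?_
    simp [hx]
  have hg : ∀ i, chiT p x (gT F i) = 0 := by
    intro i
    simp [gT, hr]
  have h : (chiT p x).comp (psi F) = Polynomial.mapRingHom (thetaB p x) := by
    apply Polynomial.ringHom_ext'
    · apply MvPolynomial.ringHom_ext
      · intro r; simp
      · rintro (i | (_ | i))
        · simp [psi, psiB, chiT, thetaB, tT]
        · simp [psi, psiB, qT, hg]
          simp [thetaB]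
        · simp [psi, psiB, qT, hg]
          simp [thetaB, chiT]
    · simp [psi, zT, chiT]
  exact congrArg (fun f : Polynomial (Bs n) →+* _ => f E) h

open Polynomial in
lemma prime_dvd_lc {n k : ℕ} (hk : 0 < k) (F : Fin k → MvPolynomial (Fin n) ℤ) (hF : ∀ i, F i ≠ 0)
    (hnoroot : ∀ x : Fin n → ℂ, ∃ i, MvPolynomial.aeval x (F i) ≠ 0)
    (E : (Bs n)[X]) (hE : E ≠ 0) (hpsi : psi F E = 0)
    (p : ℕ) (x : Fin n → ZMod p)
    (hx : ∀ i, MvPolynomial.aeval x (F i) = 0) (m) : (p : ℤ) ∣ E.leadingCoeff.coeff m := by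
  obtain ⟨R, b, hR, hRpsi, hlc⟩ := exists_R hk F hF hnoroot
  haveI : (RingHom.ker (psi F)).IsPrime := RingHom.ker_isPrime _
  obtain ⟨E0, hE0, ⟨E1, hE1⟩, ⟨R1, hR1⟩⟩ := aux_ufd (RingHom.ker (psi F)) (by
    intro b hb
    apply psiB_inj hk F hF
    rw [RingHom.mem_ker] at hb
    simpa [psi] using hb) R E hRpsi hpsi hE
  have hE0n : E0 ≠ 0 := by rintro rfl; simp at hE1; exact hE hE1
  have hR1n : R1 ≠ 0 := by rintro rfl; simp at hR1; exact hR hR1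
  obtain ⟨a, ha⟩ := aux_rename E0.leadingCoeff R1.leadingCoeff b (by rw [← leadingCoeff_mul, ← hR1, hlc]; rfl)
    (leadingCoeff_ne_zero.2 hE0n) (leadingCoeff_ne_zero.2 hR1n)
  have h1 := chi_psi F p x hx E0
  rw [RingHom.mem_ker] at hE0
  rw [hE0, map_zero] at h1
  have h2 := congrArg (fun P => P.coeff E0.natDegree) h1
  simp only [coeff_zero, coeff_map, coeff_natDegree, ha] at h2
  have h3 : (thetaB p x).comp rn = MvPolynomial.map (Int.castRingHom (ZMod p)) := by
    apply MvPolynomial.ringHom_ext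
    · intro r; simp
    · intro w; simp [thetaB, rn]
  have h4 : MvPolynomial.map (Int.castRingHom (ZMod p)) a = 0 := by
    rw [← h3]; exact h2.symm
  have h5 : MvPolynomial.map (Int.castRingHom (ZMod p)) E.leadingCoeff = 0 := by
    rw [hE1, leadingCoeff_mul, map_mul, ha, MvPolynomial.map_rename, h4, map_zero, zero_mul]
  have h6 := congrArg (MvPolynomial.coeff m) h5
  rw [MvPolynomial.coeff_map, MvPolynomial.coeff_zero] at h6
  exact (ZMod.intCast_zmod_eq_zero_iff_dvd _ _).1 h6

def Wd (σ : Type) [Fintype σ] (T : ℕ) : Finset (σ →₀ ℕ) :=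
  (Finset.range (T+1)).biUnion fun i => Finset.univ.finsuppAntidiag i

lemma mem_Wd {σ : Type} [Fintype σ] {T : ℕ} {m : σ →₀ ℕ} : m ∈ Wd σ T ↔ ∑ i, m i ≤ T := by
  simp [Wd, Finset.mem_finsuppAntidiag]

lemma card_Wd (σ : Type) [Fintype σ] (T : ℕ) :
    (Wd σ T).card = (T + Fintype.card σ).choose (Fintype.card σ) := by
  unfold Wd
  rw [Finset.card_biUnion]
  · simp only [Finset.card_finsuppAntidiag_nat_eq_multichoose, Finset.card_univ]
    rw [Nat.sum_range_multichoose]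
  · intro i _ j _ hij
    rw [Function.onFun, Finset.disjoint_left]
    intro m hm hm'
    simp [Finset.mem_finsuppAntidiag] at hm hm'
    omega

def okS {n : ℕ} (m d : ℕ) (s : (Option (Option (Fin n)) ⊕ Fin n) →₀ ℕ) : Prop :=
  (∀ o, s (Sum.inl o) ≤ m) ∧ ∑ j, s (Sum.inr j) ≤ d

def Bd {n : ℕ} (l : ℤ) (m d : ℕ) (P : Tg n) : Prop :=
  ∃ (ι : Type) (_ : Fintype ι) (s : ι → ((Option (Option (Fin n)) ⊕ Fin n) →₀ ℕ)) (c : ι → ℤ),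
    P = ∑ i, MvPolynomial.monomial (s i) (c i) ∧ (∑ i, |c i|) ≤ l ∧ ∀ i, okS m d (s i)

namespace Bd
variable {n : ℕ} {l l' : ℤ} {m m' d d' : ℕ} {P Q : Tg n}

lemma nonneg (h : Bd l m d P) : 0 ≤ l := by
  obtain ⟨ι, _, s, c, hP, hl, ho⟩ := h
  exact (Finset.sum_nonneg fun i _ => abs_nonneg _).trans hl

lemma mono (h : Bd l m d P) (hl' : l ≤ l') (hm : m ≤ m') (hd : d ≤ d') : Bd l' m' d' P := by
  obtain ⟨ι, _, s, c, hP, hl, ho⟩ := h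
  exact ⟨ι, _, s, c, hP, hl.trans hl', fun i => ⟨fun o => ((ho i).1 o).trans hm, (ho i).2.trans hd⟩⟩

lemma add (h : Bd l m d P) (h' : Bd l' m d Q) : Bd (l + l') m d (P + Q) := by
  obtain ⟨ι, _, s, c, hP, hl, ho⟩ := h
  obtain ⟨ι', _, s', c', hP', hl', ho'⟩ := h'
  refine ⟨ι ⊕ ι', inferInstance, Sum.elim s s', Sum.elim c c', ?_, ?_, ?_⟩
  · simp [hP, hP']
  · simp; linarith
  · rintro (i | i)
    · exact ho i
    · exact ho' i

lemma mul (h : Bd l m d P) (h' : Bd l' m' d' Q) : Bd (l * l') (m + m') (d + d') (P * Q) := by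
  have h0 := h.nonneg
  obtain ⟨ι, _, s, c, hP, hl, ho⟩ := h
  obtain ⟨ι', _, s', c', hP', hl', ho'⟩ := h'
  refine ⟨ι × ι', inferInstance, fun i => s i.1 + s' i.2, fun i => c i.1 * c' i.2, ?_, ?_, ?_⟩
  · rw [hP, hP', Finset.sum_mul_sum, Fintype.sum_prod_type]
    simp [MvPolynomial.monomial_mul]
  · simp only [abs_mul]
    rw [Fintype.sum_prod_type]
    simp only [← Finset.mul_sum, ← Finset.sum_mul]
    exact mul_le_mul hl hl' (Finset.sum_nonneg fun i _ => abs_nonneg _) h0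
  · rintro ⟨i, i'⟩
    refine ⟨fun o => add_le_add ((ho i).1 o) ((ho' i').1 o), ?_⟩
    simp only [Finsupp.add_apply, Finset.sum_add_distrib]
    exact add_le_add (ho i).2 (ho' i').2

lemma mon (s : (Option (Option (Fin n)) ⊕ Fin n) →₀ ℕ) (c : ℤ) (h : okS m d s) :
    Bd |c| m d (MvPolynomial.monomial s c : Tg n) :=
  ⟨Unit, inferInstance, fun _ => s, fun _ => c, by simp, by simp, fun _ => h⟩

lemma one : Bd 1 0 0 (1 : Tg n) := by
  have := mon (n := n) (m := 0) (d := 0) 0 1 ⟨by simp, by simp⟩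
  simpa using this

lemma zero (m d : ℕ) : Bd 0 m d (0 : Tg n) := 
  ⟨Empty, inferInstance, Empty.elim, Empty.elim, by simp, by simp, fun i => i.elim⟩

lemma pow (h : Bd l m d P) (a : ℕ) : Bd (l ^ a) (a * m) (a * d) (P ^ a) := by
  induction a with
  | zero => simpa using one
  | succ a ih =>
    rw [pow_succ, pow_succ]
    have := ih.mul h
    rwa [← Nat.succ_mul, ← Nat.succ_mul] at this

lemma prod {ι : Type} (S : Finset ι) (P : ι → Tg n) (a : ι → ℕ) (h : ∀ i, Bd l m d (P i)) :
    Bd (l ^ (∑ i ∈ S, a i)) ((∑ i ∈ S, a i) * m) ((∑ i ∈ S, a i) * d) (∏ i ∈ S, P i ^ a i) := by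
  induction S using Finset.induction_on with
  | empty => simpa using one
  | insert i S hi ih =>
    rw [Finset.prod_insert hi, Finset.sum_insert hi, pow_add, add_mul, add_mul]
    exact ((h i).pow _).mul ih

lemma sum {ι : Type} (S : Finset ι) (P : ι → Tg n) (h : ∀ i ∈ S, Bd l m d (P i)) :
    Bd (S.card * l) m d (∑ i ∈ S, P i) := by
  induction S using Finset.induction_on with
  | empty => simpa using zero m d
  | insert i S hi ih =>
    rw [Finset.sum_insert hi, Finset.card_insert_of_notMem hi]
    refine ((h i (by simp)).add (ih fun i hi => h i (by simp [hi]))).mono ?_ le_rfl le_rfl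
    push_cast; linarith

lemma coeff_le (h : Bd l m d P) (s) : |P.coeff s| ≤ l := by
  obtain ⟨ι, _, s', c, hP, hl, ho⟩ := h
  rw [hP, MvPolynomial.coeff_sum]
  refine (Finset.abs_sum_le_sum_abs _ _).trans (le_trans (Finset.sum_le_sum fun i _ => ?_) hl)
  rw [MvPolynomial.coeff_monomial]
  split_ifs <;> simp

lemma ok (h : Bd l m d P) (s) (hs : P.coeff s ≠ 0) : okS m d s := by
  obtain ⟨ι, _, s', c, hP, hl, ho⟩ := h
  rw [hP, MvPolynomial.coeff_sum] at hs
  obtain ⟨i, _, hi⟩ := Finset.exists_ne_zero_of_sum_ne_zero hs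
  rw [MvPolynomial.coeff_monomial] at hi
  split_ifs at hi with h
  · exact h ▸ ho i
  · exact absurd rfl hi
end Bd

lemma bd_F {n : ℕ} (G : MvPolynomial (Fin n) ℤ) (D : ℕ) (hD : G.totalDegree ≤ D) (H : ℕ)
    (hH : ∀ s, (G.coeff s).natAbs ≤ H) :
    Bd (((D + n).choose n : ℕ) * (H : ℤ)) 0 D (MvPolynomial.rename Sum.inr G : Tg n) := by
  have hsup : G.support ⊆ Wd (Fin n) D := by
    intro s hs
    rw [mem_Wd]
    have := MvPolynomial.le_totalDegree hs
    rw [Finsupp.sum_fintype _ _ (by simp)] at this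
    omega
  have hcard : G.support.card ≤ (D + n).choose n := by
    have := Finset.card_le_card hsup
    rwa [card_Wd, Fintype.card_fin] at this
  rw [G.as_sum, map_sum]
  refine (Bd.sum (l := H) G.support _ ?_).mono ?_ le_rfl le_rfl
  · intro s hs
    rw [MvPolynomial.rename_monomial]
    refine (Bd.mon (m := 0) (d := D) _ _ ⟨?_, ?_⟩).mono ?_ le_rfl le_rfl
    · intro o
      rw [Finsupp.mapDomain_of_notMem_range _ _ (by simp)]
    · simp only [Finsupp.mapDomain_apply Sum.inr_injective]
      exact mem_Wd.1 (hsup hs)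
    · rw [Int.abs_eq_natAbs]
      exact_mod_cast hH s
  · exact mul_le_mul_of_nonneg_right (by exact_mod_cast hcard) (by positivity)

lemma bd_q {n k : ℕ} (hk : 0 < k) (F : Fin k → MvPolynomial (Fin n) ℤ) (D : ℕ) (hD1 : 1 ≤ D)
    (hD : ∀ j, (F j).totalDegree ≤ D) (H : ℕ)
    (hH : ∀ j s, ((F j).coeff s).natAbs ≤ H) (i) :
    Bd (1 + k * (((D + n).choose n : ℕ) * (H : ℤ))) k D (qT F i) := by
  unfold qT
  apply Bd.add
  · cases i with
    | none => exact (Bd.zero k D).mono (by norm_num) le_rfl le_rfl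
    | some j =>
      refine (Bd.mon (m := k) (d := D) (Finsupp.single (Sum.inr j) 1) 1 ⟨?_, ?_⟩).mono (by simp) le_rfl le_rfl
      · intro o; simp
      · rw [Finset.sum_eq_single j]
        · simpa using hD1
        · intro b _ hb; rw [Finsupp.single_apply, if_neg]; simpa using hb.symm
        · simp
  · unfold gT
    rw [Finset.mul_sum]
    have := Bd.sum (l := (((D + n).choose n : ℕ) * (H : ℤ))) (m := k) (d := D) (n := n) (Finset.univ : Finset (Fin k))
      (fun j => zT n * (tT i ^ (j.val+1) * MvPolynomial.rename Sum.inr (F j))) ?_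
    · simpa using this
    · intro j _
      have h1 : Bd 1 k 0 (zT n * tT i ^ (j.val+1)) := by
        have : zT n * tT i ^ (j.val+1) = MvPolynomial.monomial (Finsupp.single (Sum.inl none) 1 + Finsupp.single (Sum.inl (some i)) (j.val+1)) (1:ℤ) := by
          rw [zT, tT, MvPolynomial.X_pow_eq_monomial, MvPolynomial.X, MvPolynomial.monomial_mul, mul_one]
        rw [this]
        refine (Bd.mon _ _ ⟨?_, ?_⟩).mono (by simp) le_rfl le_rfl
        · intro o
          have := j.2
          rcases o with _ | o
          · simp; omega
          · simp [Finsupp.single_apply]; split_ifs <;> omega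
        · simp
      rw [← mul_assoc]
      have := h1.mul (bd_F (F j) D (hD j) H (hH j))
      simpa using this

def expT {n : ℕ} (c : Option (Option (Fin n)) → ℕ) (w : Fin n →₀ ℕ) : (Option (Option (Fin n)) ⊕ Fin n) →₀ ℕ :=
  Finsupp.sumElim (Finsupp.equivFunOnFinite.symm c) w

def expB {n : ℕ} (c : Option (Option (Fin n)) → ℕ) (a : Option (Fin n) →₀ ℕ) : (Option (Fin n) ⊕ Option (Fin n)) →₀ ℕ :=
  Finsupp.sumElim (Finsupp.equivFunOnFinite.symm (fun i => c (some i))) a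

def monoB {n : ℕ} (c : Option (Option (Fin n)) → ℕ) (a : Option (Fin n) →₀ ℕ) : Polynomial (Bs n) :=
  Polynomial.monomial (c none) (MvPolynomial.monomial (expB c a) 1)

lemma psi_monoB {n k : ℕ} (F : Fin k → MvPolynomial (Fin n) ℤ) (c : Option (Option (Fin n)) → ℕ) (a : Option (Fin n) →₀ ℕ) :
    psi F (monoB c a) = MvPolynomial.monomial (expT c 0) 1 * ∏ i, qT F i ^ a i := by
  have h1 : psi F (monoB c a) = (∏ i, tT i ^ c (some i)) * (∏ i, qT F i ^ a i) * zT n ^ c none := by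
    simp only [psi, monoB, Polynomial.coe_eval₂RingHom, Polynomial.eval₂_monomial, psiB, RingHom.coe_coe,
      MvPolynomial.aeval_monomial, map_one, one_mul]
    rw [Finsupp.prod_fintype _ _ (by simp), Fintype.prod_sum_type]
    simp [expB]
  have h2 : (MvPolynomial.monomial (expT c 0) 1 : Tg n) = (∏ i, tT i ^ c (some i)) * zT n ^ c none := by
    rw [MvPolynomial.monomial_eq, Finsupp.prod_fintype _ _ (by simp), Fintype.prod_sum_type, Fintype.prod_option]
    simp [expT, tT, zT]
    ring
  rw [h1, h2]; ring

lemma bd_mono {n k : ℕ} (hk : 0 < k) (F : Fin k → MvPolynomial (Fin n) ℤ) (D : ℕ) (hD1 : 1 ≤ D)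
    (hD : ∀ j, (F j).totalDegree ≤ D) (H : ℕ)
    (hH : ∀ j s, ((F j).coeff s).natAbs ≤ H) (M T : ℕ) (c : Option (Option (Fin n)) → ℕ) (a : Option (Fin n) →₀ ℕ)
    (hc : ∀ o, c o ≤ M) (ha : ∑ i, a i ≤ T) :
    Bd ((1 + k * (((D + n).choose n : ℕ) * (H : ℤ))) ^ T) (M + T * k) (T * D) (psi F (monoB c a)) := by
  rw [psi_monoB]
  have h1 : Bd 1 M 0 (MvPolynomial.monomial (expT c 0) 1 : Tg n) := by
    refine (Bd.mon _ _ ⟨?_, ?_⟩).mono (by simp) le_rfl le_rfl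
    · intro o; simpa [expT] using hc o
    · simp [expT]
  have h2 := Bd.prod Finset.univ (qT F) a (bd_q hk F D hD1 hD H hH)
  refine (h1.mul h2).mono ?_ ?_ ?_
  · rw [one_mul]
    refine pow_le_pow_right₀ ?_ ha
    have : (0:ℤ) ≤ k * (((D + n).choose n : ℕ) * (H : ℤ)) := by positivity
    linarith
  · gcongr
  · rw [zero_add]; gcongr

attribute [local instance] Matrix.seminormedAddCommGroup

lemma siegel {n k : ℕ} (hk : 0 < k) (F : Fin k → MvPolynomial (Fin n) ℤ) (D : ℕ) (hD1 : 1 ≤ D)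
    (hD : ∀ j, (F j).totalDegree ≤ D) (H : ℕ)
    (hH : ∀ j s, ((F j).coeff s).natAbs ≤ H) (M T : ℕ) (N : ℕ)
    (hN : N = (M + 1) ^ (n + 2) * (T + (n + 1)).choose (n + 1))
    (hNJ : 3 * ((M + T * k + 1) ^ (n + 2) * (T * D + n).choose n) ≤ N) :
    ∃ E : Polynomial (Bs n), E ≠ 0 ∧ psi F E = 0 ∧ ∀ b s, 
      (((E.coeff b).coeff s).natAbs : ℝ) ^ 2 ≤ N * ((1 + k * (((D + n).choose n : ℕ) * (H : ℝ))) ^ T) := by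
  let β := (Option (Option (Fin n)) → Fin (M+1)) × (Wd (Option (Fin n)) T)
  let α := (Option (Option (Fin n)) → Fin (M+T*k+1)) × (Wd (Fin n) (T*D))
  have hβ : Fintype.card β = N := by
    rw [hN]
    simp [β, card_Wd]
  set J := Fintype.card α with hJ
  have hα : J = (M + T * k + 1) ^ (n + 2) * (T * D + n).choose n := by
    simp [hJ, α, card_Wd]
  have hJpos : 0 < J := by
    rw [hα]
    have : 0 < (T * D + n).choose n := Nat.choose_pos (by omega)
    positivity
  rw [← hα] at hNJ
  let mB : β → Polynomial (Bs n) := fun x => monoB (fun o => (x.1 o).val) x.2.1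
  let A : Matrix α β ℤ := fun r x => (psi F (mB x)).coeff (expT (fun o => (r.1 o).val) r.2.1)
  have hbd : ∀ x, Bd ((1 + k * (((D + n).choose n : ℕ) * (H : ℤ))) ^ T) (M + T * k) (T * D) (psi F (mB x)) := by
    intro x
    exact bd_mono hk F D hD1 hD H hH M T _ _ (fun o => by have := (x.1 o).2; omega) (mem_Wd.1 x.2.2)
  obtain ⟨t, ht0, htA, htn⟩ := Int.Matrix.exists_ne_zero_int_vec_norm_le A (by rw [hβ]; omega) hJpos
  rw [hβ] at htn
  set L : ℝ := (1 + k * (((D + n).choose n : ℕ) * (H : ℝ))) ^ T with hL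
  have hL1 : 1 ≤ L := by
    apply one_le_pow₀
    have : (0:ℝ) ≤ k * (((D + n).choose n : ℕ) * (H : ℝ)) := by positivity
    linarith
  have hAL : max 1 ‖A‖ ≤ L := by
    apply max_le hL1
    rw [Matrix.norm_le_iff (by linarith)]
    intro r x
    rw [Int.norm_eq_abs]
    have := (hbd x).coeff_le (expT (fun o => (r.1 o).val) r.2.1)
    rw [hL]
    exact_mod_cast this
  have hN1 : (1:ℝ) ≤ N := by
    have : 1 ≤ N := by omega
    exact_mod_cast this
  have hNJ' : (3:ℝ) * J ≤ N := by exact_mod_cast hNJ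
  have hJ' : (0:ℝ) < J := by exact_mod_cast hJpos
  have htn2 : ‖t‖ ^ 2 ≤ N * L := by
    have h1 : ‖t‖ ≤ (N * L) ^ ((1:ℝ)/2) := by
      refine htn.trans ?_
      refine (Real.rpow_le_rpow (by positivity) (mul_le_mul_of_nonneg_left hAL (by positivity)) ?_).trans ?_
      · apply div_nonneg hJ'.le; linarith
      · apply Real.rpow_le_rpow_of_exponent_le (by nlinarith)
        rw [div_le_div_iff₀ (by linarith) (by norm_num)]
        linarith
    rw [← Real.sqrt_eq_rpow] at h1
    rw [← Real.sqrt_le_sqrt_iff (by positivity), Real.sqrt_sq (norm_nonneg _)]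
    exact h1
  have hcoef : ∀ b s (x : β), ((mB x).coeff b).coeff s = if (x.1 none).val = b ∧ expB (fun o => (x.1 o).val) x.2.1 = s then 1 else 0 := by
    intro b s x
    simp only [mB, monoB, Polynomial.coeff_monomial]
    by_cases h1 : (x.1 none).val = b
    · simp only [h1, if_true, true_and, MvPolynomial.coeff_monomial]
    · simp [h1]
  have hinj : ∀ x y : β, (x.1 none).val = (y.1 none).val → expB (fun o => (x.1 o).val) x.2.1 = expB (fun o => (y.1 o).val) y.2.1 → x = y := by
    rintro ⟨x, x'⟩ ⟨y, y'⟩ h1 h2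
    have h3 : ∀ i, expB (fun o => (x o).val) x'.1 i = expB (fun o => (y o).val) y'.1 i := fun i => by rw [h2]
    apply Prod.ext
    · funext o
      rcases o with _ | o
      · exact Fin.ext h1
      · exact Fin.ext (by simpa [expB] using h3 (Sum.inl o))
    · apply Subtype.ext
      ext i
      simpa [expB] using h3 (Sum.inr i)
  let E : Polynomial (Bs n) := ∑ x, t x • mB x
  have hEc : ∀ b s, (E.coeff b).coeff s = ∑ x, t x * ((mB x).coeff b).coeff s := by
    intro b s
    simp only [E, Polynomial.finsetSum_coeff, MvPolynomial.coeff_sum, Polynomial.coeff_smul, MvPolynomial.coeff_smul, smul_eq_mul]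
  have hEx : ∀ x : β, (E.coeff (x.1 none).val).coeff (expB (fun o => (x.1 o).val) x.2.1) = t x := by
    intro x
    rw [hEc, Finset.sum_eq_single x]
    · rw [hcoef, if_pos ⟨rfl, rfl⟩, mul_one]
    · intro y _ hy
      rw [hcoef, if_neg, mul_zero]
      rintro ⟨h1, h2⟩
      exact hy (hinj _ _ h1 h2)
    · simp
  refine ⟨E, ?_, ?_, ?_⟩
  · intro h0
    apply ht0
    funext x
    rw [← hEx x, h0]; simp
  · ext s
    have h1 : (psi F E).coeff s = ∑ x, t x * (psi F (mB x)).coeff s := by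
      simp only [E, map_sum, map_zsmul, MvPolynomial.coeff_sum, MvPolynomial.coeff_smul, smul_eq_mul]
    rw [h1, MvPolynomial.coeff_zero]
    by_cases hs : okS (M + T * k) (T * D) s
    · let r : α := (fun o => ⟨s (Sum.inl o), Nat.lt_succ_of_le (hs.1 o)⟩, 
        ⟨Finsupp.equivFunOnFinite.symm fun j => s (Sum.inr j), mem_Wd.2 (by simpa using hs.2)⟩)
      have h2 : expT (fun o => (r.1 o).val) r.2.1 = s := by
        ext (o | j)
        · simp [expT, r]
        · simp [expT, r]
      have h3 := congrFun htA r
      simp only [Matrix.mulVec, dotProduct, A, h2, Pi.zero_apply] at h3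
      rw [← h3]
      exact Finset.sum_congr rfl fun x _ => mul_comm _ _
    · apply Finset.sum_eq_zero
      intro x _
      by_contra hne
      exact hs ((hbd x).ok s (right_ne_zero_of_mul hne))
  · intro b s
    by_cases hx : ∃ x : β, (x.1 none).val = b ∧ expB (fun o => (x.1 o).val) x.2.1 = s
    · obtain ⟨x, rfl, rfl⟩ := hx
      rw [hEx]
      refine le_trans ?_ htn2
      have := norm_le_pi_norm t x
      rw [Int.norm_eq_abs] at this
      rw [Nat.cast_natAbs]
      push_cast
      exact pow_le_pow_left₀ (abs_nonneg _) this 2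
    · push Not at hx
      rw [hEc, Finset.sum_eq_zero]
      · simp; positivity
      · intro x _
        rw [hcoef, if_neg, mul_zero]
        rintro ⟨h1, h2⟩
        exact hx x h1 h2

lemma choose_scale (D T : ℕ) (hD : 1 ≤ D) (n : ℕ) :
    (T * D + n).choose n ≤ D ^ n * (T + n).choose n := by
  induction n with
  | zero => simp
  | succ n ih =>
    have h1 := Nat.add_one_mul_choose_eq (T * D + n) n
    have h2 := Nat.add_one_mul_choose_eq (T + n) n
    have h3 : T * D + n + 1 ≤ D * (T + n + 1) := by nlinarith
    have h4 : (T * D + n + 1) * (T * D + n).choose n ≤ (D * (T + n + 1)) * (D ^ n * (T + n).choose n) :=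
      Nat.mul_le_mul h3 ih
    rw [h1] at h4
    have h5 : (D * (T + n + 1)) * (D ^ n * (T + n).choose n) = (D ^ (n+1) * (T + n + 1).choose (n+1)) * (n+1) := by
      rw [mul_assoc (D ^ (n+1)), ← h2]; ring
    rw [h5] at h4
    exact Nat.le_of_mul_le_mul_right h4 (by omega)

lemma choose_one (D : ℕ) (hD : 1 ≤ D) (n : ℕ) : (D + n).choose n ≤ (n + 1) * D ^ n := by
  have := choose_scale D 1 hD n
  rw [one_mul, add_comm 1 n, Nat.choose_succ_self_right] at this
  linarith

lemma box_ineq (n u m : ℕ) (hm : m = 4 * (n + 2) * u) (hu : 0 < u) :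
    3 * (m + u) ^ (n + 2) ≤ 4 * m ^ (n + 2) := by
  have h1 : (0:ℝ) < m + u := by positivity
  have h2 := one_add_mul_le_pow (a := -((u:ℝ) / (m + u))) (by
    have : (u:ℝ) / (m + u) ≤ 1 := by rw [div_le_one h1]; have : (0:ℝ) ≤ m := by positivity
                                     linarith
    linarith) (n + 2)
  have h3 : (1 + -((u:ℝ) / (m + u))) = m / (m + u) := by field_simp; ring
  rw [h3, div_pow, le_div_iff₀ (by positivity)] at h2
  have h4 : (3:ℝ)/4 ≤ 1 + ((n + 2 : ℕ) : ℝ) * -((u:ℝ) / (m + u)) := by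
    have : ((n + 2 : ℕ) : ℝ) * ((u:ℝ) / (m + u)) ≤ 1 / 4 := by
      rw [← mul_div_assoc, div_le_div_iff₀ h1 (by norm_num)]
      rw [hm]; push_cast
      have : (0:ℝ) ≤ u := by positivity
      nlinarith
    linarith
  have h5 : (3:ℝ)/4 * ((m:ℝ) + u) ^ (n+2) ≤ (m:ℝ) ^ (n+2) := 
    (mul_le_mul_of_nonneg_right h4 (by positivity)).trans h2
  have h6 : (3:ℝ) * ((m:ℝ) + u) ^ (n+2) ≤ 4 * (m:ℝ) ^ (n+2) := by linarith
  exact_mod_cast h6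

lemma count_ineq (n k D T M : ℕ) (hk : 0 < k) (hD : 1 ≤ D) (hT : T = 4 * ((n + 1) * D ^ n))
    (hM : M + 1 = 4 * (n + 2) * (T * k)) :
    3 * ((M + T * k + 1) ^ (n + 2) * (T * D + n).choose n) ≤ (M + 1) ^ (n + 2) * (T + (n + 1)).choose (n + 1) := by
  have hDn : 0 < D ^ n := by positivity
  have hT0 : 0 < T := by rw [hT]; positivity
  have h1 := box_ineq n (T * k) (M + 1) hM (by positivity)
  have h2 := choose_scale D T hD n
  have h3 := Nat.add_one_mul_choose_eq (T + n) n
  have h4 : 4 * (T * D + n).choose n ≤ (T + (n + 1)).choose (n + 1) := by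
    refine Nat.le_of_mul_le_mul_right (c := n + 1) ?_ (by omega)
    rw [← add_assoc, ← h3]
    calc 4 * (T * D + n).choose n * (n + 1) ≤ 4 * (D ^ n * (T + n).choose n) * (n + 1) := by gcongr
      _ = T * (T + n).choose n := by rw [hT]; ring
      _ ≤ _ := by gcongr; omega
  rw [show M + T * k + 1 = M + 1 + T * k by ring]
  refine Nat.le_of_mul_le_mul_left (c := 4) ?_ (by norm_num) 
  calc 4 * (3 * ((M + 1 + T * k) ^ (n + 2) * (T * D + n).choose n)) = (3 * (M + 1 + T * k) ^ (n + 2)) * (4 * (T * D + n).choose n) := by ring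
    _ ≤ (4 * (M + 1) ^ (n + 2)) * (T + (n + 1)).choose (n + 1) := Nat.mul_le_mul h1 h4
    _ = _ := by ring

lemma real_fin_a (n Q : ℝ) (hnr : 1 ≤ n) (hQn : n + 1 ≤ Q) :
    (2 + (n + 2) * (n + 1) + (n + 6) * (n + 2)) + 4 * Q * (n + 1) ≤ 1.386 * (4 * n * Q * (n + 7)) := by
  obtain ⟨a, rfl⟩ : ∃ a, n = 1 + a := ⟨n - 1, by ring⟩
  obtain ⟨b, rfl⟩ : ∃ b, Q = 2 + a + b := ⟨Q - 2 - a, by ring⟩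
  have ha : 0 ≤ a := by linarith
  have hb : 0 ≤ b := by linarith
  rw [← sub_nonneg]
  ring_nf
  positivity

lemma real_fin (n Q a b x : ℝ) (hnr : 1 ≤ n) (hQn : n + 1 ≤ Q) (ha : 0 ≤ a) (hb : 0 ≤ b) (hx : 0 ≤ x) :
    (n + 2) * b + (2 + (n + 2) * (n + 1) + (n + 6) * (n + 2)) * x + 4 * Q * (b + a + (n + 1) * x) ≤
      1.386 * (4 * n * Q * (a + b + (n + 7) * x)) := by
  have b2 : 4 * Q ≤ 1.386 * (4 * n * Q) := by nlinarith
  have b3 : 4 * Q + (n + 2) ≤ 1.386 * (4 * n * Q) := by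
    nlinarith [mul_nonneg (sub_nonneg.2 hnr) (sub_nonneg.2 hQn)]
  have b4 := real_fin_a n Q hnr hQn
  have c2 := mul_le_mul_of_nonneg_right b2 ha
  have c3 := mul_le_mul_of_nonneg_right b3 hb
  have c4 := mul_le_mul_of_nonneg_right b4 hx
  linarith

lemma num_ineq (n k D T M H N c : ℕ) (hn : 0 < n) (hk : 0 < k) (hD : 1 ≤ D) (hH : 1 ≤ H)
    (hT : T = 4 * ((n + 1) * D ^ n))
    (hM : M + 1 = 4 * (n + 2) * (T * k))
    (hN : N = (M + 1) ^ (n + 2) * (T + (n + 1)).choose (n + 1))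
    (e : ℕ) (he : (e:ℝ) ^ 2 ≤ N * ((1 + k * (((D + n).choose n : ℕ) * (H : ℝ))) ^ T))
    (hc : 2 ^ c ≤ e) :
    (c : ℝ) ≤ 4 * n * (n + 1) * (D : ℝ) ^ n *
          (Real.log H + Real.log k + (n + 7) * Real.log ((n + 1) * D)) := by
  have hX2 : 2 ≤ (n + 1) * D := by nlinarith
  have hXn : (n + 1) * D ^ n ≤ ((n + 1) * D) ^ n := by
    rw [mul_pow]
    gcongr
    exact Nat.le_self_pow (by omega) _
  have hXn1 : n + 1 ≤ (n + 1) * D := by nlinarith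
  set X := (n + 1) * D with hX
  have h4 : 4 ≤ X ^ 2 := by nlinarith
  have hn2 : n + 2 ≤ X ^ 2 := by nlinarith
  have hTX : T ≤ X ^ (n + 2) := by
    rw [hT, add_comm n 2, pow_add]
    exact Nat.mul_le_mul h4 hXn
  have hT1 : 1 ≤ T := by rw [hT]; have : 0 < D ^ n := by positivity
                         nlinarith
  have hch : (T + (n + 1)).choose (n + 1) ≤ X ^ (2 + (n + 2) * (n + 1)) := by
    refine (choose_one T hT1 (n+1)).trans ?_
    rw [pow_add X, pow_mul X]
    exact Nat.mul_le_mul hn2 (Nat.pow_le_pow_left hTX _)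
  have hbox : (M + 1) ^ (n + 2) ≤ k ^ (n + 2) * X ^ ((n + 6) * (n + 2)) := by
    rw [hM, pow_mul, ← mul_pow]
    apply Nat.pow_le_pow_left
    calc 4 * (n + 2) * (T * k) = k * (4 * (n + 2) * T) := by ring
      _ ≤ k * (X ^ 2 * X ^ 2 * X ^ (n + 2)) := by gcongr
      _ = _ := by ring
  have hNle : N ≤ k ^ (n + 2) * X ^ (2 + (n + 2) * (n + 1) + (n + 6) * (n + 2)) := by
    rw [hN]
    refine (Nat.mul_le_mul hbox hch).trans (le_of_eq ?_)
    rw [pow_add _ (2 + _)]; ring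
  have hLle : 1 + k * ((D + n).choose n * H) ≤ k * H * X ^ (n + 1) := by
    have h5 := choose_one D hD n
    have h6 : (D + n).choose n + 1 ≤ X ^ (n + 1) := by
      rw [pow_succ]
      have : 0 < D ^ n := by positivity
      nlinarith
    have h7 : 1 ≤ k * H := Nat.mul_pos hk hH
    calc 1 + k * ((D + n).choose n * H) ≤ k * H + k * ((D + n).choose n * H) := by omega
      _ = k * H * ((D + n).choose n + 1) := by ring
      _ ≤ _ := by gcongr
  have hkr : (0:ℝ) < k := by exact_mod_cast hk
  have hHr : (0:ℝ) < H := by exact_mod_cast hH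
  have hXr : (0:ℝ) < X := by exact_mod_cast (by omega : 0 < X)
  have hlk : 0 ≤ Real.log k := Real.log_nonneg (by exact_mod_cast hk)
  have hlH : 0 ≤ Real.log H := Real.log_nonneg (by exact_mod_cast hH)
  have hlX : 0 ≤ Real.log X := Real.log_nonneg (by exact_mod_cast (by omega : 1 ≤ X))
  have hmain : ((2:ℝ) ^ c) ^ 2 ≤ ((k:ℝ) ^ (n + 2) * (X:ℝ) ^ (2 + (n + 2) * (n + 1) + (n + 6) * (n + 2))) * ((k:ℝ) * H * (X:ℝ) ^ (n + 1)) ^ T := by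
    have hc' : (2:ℝ) ^ c ≤ e := by exact_mod_cast hc
    refine (pow_le_pow_left₀ (by positivity) hc' 2).trans (he.trans ?_)
    have a1 : (N:ℝ) ≤ (k:ℝ) ^ (n + 2) * (X:ℝ) ^ (2 + (n + 2) * (n + 1) + (n + 6) * (n + 2)) := by exact_mod_cast hNle
    have a2 : 1 + (k:ℝ) * (((D + n).choose n : ℕ) * (H : ℝ)) ≤ (k:ℝ) * H * (X:ℝ) ^ (n + 1) := by exact_mod_cast hLle
    gcongr
  have hlog := Real.log_le_log (by positivity) hmain
  rw [Real.log_mul (by positivity) (by positivity), Real.log_mul (by positivity) (by positivity)] at hlog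
  simp only [Real.log_pow] at hlog
  rw [Real.log_mul (by positivity) (by positivity), Real.log_mul (by positivity) (by positivity)] at hlog
  simp only [Real.log_pow] at hlog
  have hXc : ((n:ℝ) + 1) * D = (X:ℝ) := by rw [hX]; push_cast; ring
  rw [hXc]
  rw [hT] at hlog
  push_cast at hlog
  set Q : ℝ := ((n:ℝ) + 1) * (D:ℝ) ^ n with hQ
  have hQn : (n:ℝ) + 1 ≤ Q := by
    have : (1:ℝ) ≤ (D:ℝ) ^ n := one_le_pow₀ (by exact_mod_cast hD)
    rw [hQ]; nlinarith
  have hnr : (1:ℝ) ≤ n := by exact_mod_cast hn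
  have hl2 : (0.693:ℝ) ≤ Real.log 2 := by linarith [Real.log_two_gt_d9]
  have hc0 : (0:ℝ) ≤ c := by positivity
  have hfin : 1.386 * (c:ℝ) ≤ 1.386 * (4 * n * Q * (Real.log H + Real.log k + (n + 7) * Real.log X)) := by
    have b1 : 1.386 * (c:ℝ) ≤ 2 * (c * Real.log 2) := by nlinarith
    refine (b1.trans hlog).trans ?_
    have b5 := real_fin n Q (Real.log H) (Real.log k) (Real.log X) hnr hQn hlH hlk hlX
    refine le_trans (le_of_eq ?_) b5
    ring
  have hfin' := le_of_mul_le_mul_left hfin (by norm_num)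
  refine hfin'.trans (le_of_eq ?_)
  rw [hQ]; ring

/-- If `F` has no common complex zero, then the set of primes `p` for which the mod-`p`
reduction of `F` has a common zero in `𝔽_pⁿ` is finite, of cardinality at most
`A_F = 4n(n+1)Dⁿ(h + log k + (n+7) log((n+1)D))`. -/
theorem primes_with_roots_of_infeasible_bounded (n k : ℕ) (hn : 0 < n) (hk : 0 < k)
    (F : Fin k → MvPolynomial (Fin n) ℤ) (hF : ∀ i, F i ≠ 0)
    (D : ℕ) (hD : D = Finset.univ.sup fun i => (F i).totalDegree) (hD1 : 1 ≤ D)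
    (h : ℝ) (hh : (∀ i, height (F i) ≤ h) ∧ ∃ i, height (F i) = h)
    (hnoroot : ∀ x : Fin n → ℂ, ∃ i, MvPolynomial.aeval x (F i) ≠ 0) :
    {p : ℕ | p.Prime ∧ ∃ a : Fin n → ZMod p, ∀ i, MvPolynomial.aeval a (F i) = 0}.Finite ∧
      ({p : ℕ | p.Prime ∧
          ∃ a : Fin n → ZMod p, ∀ i, MvPolynomial.aeval a (F i) = 0}.ncard : ℝ) ≤
        4 * n * (n + 1) * (D : ℝ) ^ n *
          (h + Real.log k + (n + 7) * Real.log ((n + 1) * D)) := by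
  have hle : ∀ (G : MvPolynomial (Fin n) ℤ) s, (G.coeff s).natAbs ≤ G.support.sup fun m => (G.coeff m).natAbs := by
    intro G s
    by_cases hs : s ∈ G.support
    · exact Finset.le_sup (f := fun m => (G.coeff m).natAbs) hs
    · rw [MvPolynomial.notMem_support_iff.1 hs]; simp
  have hpos : ∀ (G : MvPolynomial (Fin n) ℤ), G ≠ 0 → 1 ≤ G.support.sup fun m => (G.coeff m).natAbs := by
    intro G hG
    obtain ⟨s, hs⟩ := MvPolynomial.ne_zero_iff.1 hG
    have := hle G s
    have := Int.natAbs_pos.2 hs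
    omega
  obtain ⟨hh1, i0, hi0⟩ := hh
  set H := (F i0).support.sup fun m => ((F i0).coeff m).natAbs with hHdef
  have hhH : h = Real.log H := hi0.symm
  have hH1 : 1 ≤ H := hpos _ (hF i0)
  have hHb : ∀ j s, ((F j).coeff s).natAbs ≤ H := by
    intro j s
    refine (hle (F j) s).trans ?_
    have h1 := hh1 j
    rw [hhH, height] at h1
    have h2 := (Real.log_le_log_iff (by exact_mod_cast hpos _ (hF j)) (by exact_mod_cast hH1)).1 h1
    exact_mod_cast h2
  have hDj : ∀ j, (F j).totalDegree ≤ D := by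
    intro j
    rw [hD]
    exact Finset.le_sup (f := fun i => (F i).totalDegree) (Finset.mem_univ j)
  obtain ⟨T, hT⟩ : ∃ T, T = 4 * ((n + 1) * D ^ n) := ⟨_, rfl⟩
  have hT0 : 0 < T := by rw [hT]; positivity
  obtain ⟨M, hM⟩ : ∃ M, M + 1 = 4 * (n + 2) * (T * k) :=
    ⟨4 * (n + 2) * (T * k) - 1, Nat.sub_add_cancel (Nat.succ_le_of_lt (by positivity))⟩
  obtain ⟨N, hN⟩ : ∃ N, N = (M + 1) ^ (n + 2) * (T + (n + 1)).choose (n + 1) := ⟨_, rfl⟩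
  obtain ⟨E, hE0, hEpsi, hEb⟩ := siegel hk F D hD1 hDj H hHb M T N hN
    (by rw [hN]; exact count_ineq n k D T M hk hD1 hT hM)
  obtain ⟨s, hs⟩ := MvPolynomial.ne_zero_iff.1 (Polynomial.leadingCoeff_ne_zero.2 hE0)
  set e := (E.leadingCoeff.coeff s).natAbs with he
  have he0 : 0 < e := Int.natAbs_pos.2 hs
  have hdvd : ∀ p ∈ {p : ℕ | p.Prime ∧ ∃ a : Fin n → ZMod p, ∀ i, MvPolynomial.aeval a (F i) = 0}, p ∣ e := by
    rintro p ⟨_, x, hx⟩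
    exact Int.natCast_dvd.1 (prime_dvd_lc hk F hF hnoroot E hE0 hEpsi p x hx s)
  have hsub : {p : ℕ | p.Prime ∧ ∃ a : Fin n → ZMod p, ∀ i, MvPolynomial.aeval a (F i) = 0} ⊆ (e.primeFactors : Set ℕ) := by
    intro p hp
    simp only [Finset.mem_coe, Nat.mem_primeFactors]
    exact ⟨hp.1, hdvd p hp, he0.ne'⟩
  refine ⟨(Finset.finite_toSet _).subset hsub, ?_⟩
  have hc1 : {p : ℕ | p.Prime ∧ ∃ a : Fin n → ZMod p, ∀ i, MvPolynomial.aeval a (F i) = 0}.ncard ≤ e.primeFactors.card := by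
    have := Set.ncard_le_ncard hsub (Finset.finite_toSet _)
    rwa [Set.ncard_coe_finset] at this
  have hc2 : 2 ^ e.primeFactors.card ≤ e := by
    refine le_trans ?_ (Nat.le_of_dvd he0 (Nat.prod_primeFactors_dvd e))
    exact Finset.pow_card_le_prod _ _ _ fun p hp => (Nat.prime_of_mem_primeFactors hp).two_le
  have hfin := num_ineq n k D T M H N e.primeFactors.card hn hk hD1 hH1 hT hM hN e (hEb _ _) hc2
  rw [hhH]
  exact le_trans (by exact_mod_cast hc1) hfin

end
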